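/- Let p : ℕ → S be a sequence of perfect trees on 2, let A ⊆ ω be infinite, let k ≥ 1, and let c : ⊗^A p → k be a colouring. Then there exist q : ℕ → S with q(i) ⊆ p(i) for all i < ω, and an infinite B ⊆ A, such that c is constant on ⊗^B q. -/

import Mathlib

/-- A tree on `2`: a set of finite binary sequences closed under initial segments. -/
def IsBinTree (T : Set (List Bool)) : Prop :=
  ∀ s ∈ T, ∀ t : List Bool, t <+: s → t ∈ T

/-- `s` is a splitting node of `T`. -/
def IsSplitNode (T : Set (List Bool)) (s : List Bool) : Prop :=
  s ∈ T ∧ s ++ [false] ∈ T ∧ s ++ [true] ∈ T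

/-- `T` is a perfect tree (a condition of Sacks forcing). -/
def IsPerfectTree (T : Set (List Bool)) : Prop :=
  IsBinTree T ∧ T.Nonempty ∧ ∀ s ∈ T, ∃ t, s <+: t ∧ IsSplitNode T t

/-- `t` is the (unique) minimal splitting node of `T` extending `s`, i.e. `t = sucspl_T(s)`. -/
def IsMinSplit (T : Set (List Bool)) (s t : List Bool) : Prop :=
  IsSplitNode T t ∧ s <+: t ∧ ∀ t', IsSplitNode T t' → s <+: t' → t <+: t'

/-- The `n`-th splitting level `spl_n(T)`: `spl_0(T) = {stem(T)}` and
`spl_{n+1}(T) = {sucspl_T(s⌢i) : s ∈ spl_n(T), i ∈ 2}`. -/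
def splLevel (T : Set (List Bool)) : ℕ → Set (List Bool)
  | 0 => {t | IsMinSplit T [] t}
  | n + 1 => {t | ∃ s ∈ splLevel T n, ∃ i : Bool, IsMinSplit T (s ++ [i]) t}

/-- `S ≤ₙ T` iff `S ⊆ T` and `spl_n(S) = spl_n(T)`. -/
def SacksLeN (S T : Set (List Bool)) (n : ℕ) : Prop :=
  S ⊆ T ∧ splLevel S n = splLevel T n

/-- `⊗^A p = ⋃_{n ∈ A} ∏_{i<ω} p(i)^{(n)}`: the set of all sequences `⟨s_i⟩_{i<ω}` such
that for some `n ∈ A`, `s_i` lies on the `n`-th level of `p(i)` for every `i`. -/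
def tensorProd (p : ℕ → Set (List Bool)) (A : Set ℕ) : Set (ℕ → List Bool) :=
  {x | ∃ n ∈ A, ∀ i : ℕ, x i ∈ p i ∧ (x i).length = n}


namespace HLproof

open Filter

attribute [local instance] Ultrafilter.mul Ultrafilter.semigroup

theorem map_mul_uf {S C : Type*} [Semigroup S] [Semigroup C] (f : S → C)
    (hf : ∀ x y, f (x * y) = f x * f y) (U V : Ultrafilter S) :
    (U * V).map f = U.map f * V.map f := by
  apply Ultrafilter.coe_inj.mp
  apply Filter.ext'
  intro p
  rw [Ultrafilter.eventually_mul]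
  simp only [Ultrafilter.coe_map, Filter.eventually_map]
  rw [Ultrafilter.eventually_mul]
  simp only [hf]

/-- A minimal closed left ideal with an idempotent. -/
theorem exists_min_idem (C : Type*) [Semigroup C] [Nonempty C] :
    ∃ p : Ultrafilter C, p * p = p ∧
      ∀ f : Ultrafilter C, f * f = f → p * f = f → f * p = f → f = p := by
  let S : Set (Set (Ultrafilter C)) :=
    { N | IsClosed N ∧ N.Nonempty ∧ ∀ x, ∀ m ∈ N, x * m ∈ N }
  obtain ⟨L, hL⟩ : ∃ L, Minimal (· ∈ S) L := by
    refine zorn_superset _ fun c hcs hc => ?_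
    refine ⟨⋂₀ c, ⟨isClosed_sInter fun t ht => (hcs ht).1, ?_, fun x m hm => ?_⟩, fun s hs =>
      Set.sInter_subset_of_mem hs⟩
    · obtain rfl | hcnemp := c.eq_empty_or_nonempty
      · rw [Set.sInter_empty]
        apply Set.univ_nonempty
      have := hcnemp.to_subtype
      exact IsCompact.nonempty_sInter_of_directed_nonempty_isCompact_isClosed
        (IsChain.directedOn hc.symm) (fun i hi => (hcs hi).2.1)
        (fun i hi => (hcs hi).1.isCompact) (fun i hi => (hcs hi).1)
    · rw [Set.mem_sInter]
      exact fun t ht => (hcs ht).2.2 x m (Set.mem_sInter.mp hm t ht)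
  obtain ⟨hcl, hne, hmul⟩ := hL.prop
  obtain ⟨p, hpL, hp⟩ := exists_idempotent_in_compact_subsemigroup
    Ultrafilter.continuous_mul_left L hne hcl.isCompact (fun x _ y hy => hmul x y hy)
  refine ⟨p, hp, fun f hff hpf hfp => ?_⟩
  have hfL : f ∈ L := by rw [← hfp]; exact hmul f p hpL
  have key : Set.range (· * f) = L := by
    apply hL.eq_of_subset
    · refine ⟨?_, ⟨_, ⟨f, rfl⟩⟩, ?_⟩
      · exact (isCompact_range (Ultrafilter.continuous_mul_left f)).isClosed
      · rintro x _ ⟨y, rfl⟩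
        exact ⟨x * y, mul_assoc _ _ _⟩
    · rintro _ ⟨y, rfl⟩
      exact hmul y f hfL
  rw [← key] at hpL
  obtain ⟨y, hy⟩ := hpL
  have hy' : y * f = p := hy
  have : p * f = p := by
    rw [← hy', mul_assoc, hff]
  rw [← hpf, this]

theorem exists_pq {S C Λ : Type*} [Semigroup S] [Semigroup C] [Nonempty C] (ι : C → S)
    (hι : ∀ x y, ι (x * y) = ι x * ι y) (T : Λ → S → C)
    (hT : ∀ a x y, T a (x * y) = T a x * T a y) (hTι : ∀ a x, T a (ι x) = x)
    (V : Set S) (hV : V.Nonempty) (hVl : ∀ x, ∀ y ∈ V, x * y ∈ V) (hVr : ∀ x ∈ V, ∀ y, x * y ∈ V) :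
    ∃ (p : Ultrafilter C) (q : Ultrafilter S), p * p = p ∧ V ∈ q ∧ ∀ a, q.map (T a) = p := by
  obtain ⟨p, hp, hmin⟩ := exists_min_idem C
  let P : Ultrafilter S := p.map ι
  have hP : P * P = P := by
    rw [← map_mul_uf ι hι, hp]
  have hl : ∀ x y : Ultrafilter S, V ∈ y → V ∈ x * y := by
    intro x y hy
    change ∀ᶠ m in ↑(x * y), m ∈ V
    rw [Ultrafilter.eventually_mul]
    refine Eventually.of_forall fun m => ?_
    filter_upwards [hy] with z hz using hVl m z hz
  have hr : ∀ x y : Ultrafilter S, V ∈ x → V ∈ x * y := by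
    intro x y hx
    change ∀ᶠ m in ↑(x * y), m ∈ V
    rw [Ultrafilter.eventually_mul]
    filter_upwards [hx] with z hz
    exact Eventually.of_forall fun m => hVr z hz m
  obtain ⟨v, hv⟩ := hV
  let L : Set (Ultrafilter S) := (· * P) '' {x | V ∈ x}
  obtain ⟨e, ⟨x, hx, rfl⟩, he⟩ := exists_idempotent_in_compact_subsemigroup
    Ultrafilter.continuous_mul_left L ⟨_, ⟨pure v, by simpa using hv, rfl⟩⟩
    ((ultrafilter_isClosed_basic V).isCompact.image (Ultrafilter.continuous_mul_left P))
    (by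
      rintro _ ⟨x, hx, rfl⟩ _ ⟨y, hy, rfl⟩
      exact ⟨x * P * y, hl (x * P) y hy, by simp only [mul_assoc]⟩)
  simp only at he
  set e := x * P with hedef
  have heP : e * P = e := by rw [hedef, mul_assoc, hP]
  have hVe : V ∈ e := hr _ _ hx
  refine ⟨p, P * e, hp, hl _ _ hVe, fun a => ?_⟩
  have hTP : P.map (T a) = p := by
    rw [Ultrafilter.map_map]
    have : T a ∘ ι = id := funext (hTι a)
    rw [this, Ultrafilter.map_id]
  apply hmin
  · rw [← map_mul_uf _ (hT a)]
    congr 1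
    rw [mul_assoc, ← mul_assoc e, heP, he]
  · conv_lhs => rw [← hTP]
    rw [← map_mul_uf _ (hT a), ← mul_assoc, hP]
  · conv_lhs => rw [← hTP]
    rw [← map_mul_uf _ (hT a), mul_assoc, heP]

/-- Substitution of a letter for the variable `none`. -/
def sub {Λ : Type*} (a : Λ) (w : List (Option Λ)) : List Λ := w.map (fun o => o.getD a)

/-- `w 0 (l 0) ++ ... ++ w (n-1) (l (n-1))`. -/
def W {Λ : Type*} (w : ℕ → List (Option Λ)) (l : ℕ → Λ) : ℕ → List Λ
  | 0 => []
  | n + 1 => W w l n ++ sub (l n) (w n)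

theorem W_congr {Λ : Type*} (w w' : ℕ → List (Option Λ)) (l l' : ℕ → Λ) (n : ℕ)
    (h : ∀ i < n, w i = w' i ∧ l i = l' i) : W w l n = W w' l' n := by
  induction n with
  | zero => rfl
  | succ n ih =>
    simp only [W]
    rw [ih (fun i hi => h i (by omega)), (h n (by omega)).1, (h n (by omega)).2]

theorem exists_pq_words (Λ : Type*) :
    ∃ (p : Ultrafilter (List Λ)) (q : Ultrafilter (List (Option Λ))),
      (∀ A : Set (List Λ), (∀ᶠ x : List Λ in p, x ∈ A) → ∀ᶠ x : List Λ in p, ∀ᶠ y : List Λ in p, x ++ y ∈ A) ∧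
      (∀ᶠ x : List (Option Λ) in q, none ∈ x) ∧ ∀ a, q.map (sub a) = p := by
  let _ : Semigroup (List Λ) := { mul := fun x y => x ++ y, mul_assoc := List.append_assoc }
  let _ : Semigroup (List (Option Λ)) :=
    { mul := fun x y => x ++ y, mul_assoc := List.append_assoc }
  obtain ⟨p, q, h1, h2, h3⟩ := exists_pq (S := List (Option Λ)) (C := List Λ) (Λ := Λ)
    (fun l => l.map some) (fun x y => List.map_append) sub
    (fun a x y => List.map_append) (fun a x => by simp [sub, Function.comp_def])
    {x | none ∈ x} ⟨[none], by simp⟩ (fun x y hy => List.mem_append_right _ hy)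
    (fun x hx y => List.mem_append_left _ hx)
  refine ⟨p, q, fun A hA => ?_, h2, h3⟩
  rw [← h1, Ultrafilter.eventually_mul] at hA
  exact hA

theorem carlson {Λ : Type*} (F : ℕ → Finset Λ) {k : ℕ} (col : List Λ → Fin k) :
    ∃ (j : Fin k) (w : ℕ → List (Option Λ)), (∀ n, none ∈ w n) ∧
      ∀ l : ℕ → Λ, (∀ n, l n ∈ F n) → ∀ n, col (W w l (n + 1)) = j := by
  obtain ⟨p, q, hp, hq, hpq⟩ := exists_pq_words Λ
  obtain ⟨j, hj⟩ := Ultrafilter.eq_pure_of_finite (p.map col)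
  have hA : ∀ᶠ x : List Λ in p, col x = j := by
    have : ∀ᶠ y in (p.map col), y = j := by rw [hj]; simp
    simpa using this
  let good : List Λ → Prop := fun u => ∀ᶠ y : List Λ in p, col (u ++ y) = j
  have hgood : ∀ u, good u → ∀ᶠ y : List Λ in p, col (u ++ y) = j ∧ good (u ++ y) := by
    intro u hu
    refine hu.and ?_
    have := hp {y | col (u ++ y) = j} hu
    filter_upwards [this] with x hx
    filter_upwards [hx] with y hy
    simpa using hy
  have step : ∀ (n : ℕ) (U : {U : Set (List Λ) // U.Finite ∧ ∀ u ∈ U, good u}),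
      ∃ w : List (Option Λ), none ∈ w ∧ ∀ u ∈ U.1, ∀ a ∈ F n,
        col (u ++ sub a w) = j ∧ good (u ++ sub a w) := by
    rintro n ⟨U, hU, hUg⟩
    have h : ∀ᶠ w : List (Option Λ) in q, ∀ u ∈ U, ∀ a ∈ F n,
        col (u ++ sub a w) = j ∧ good (u ++ sub a w) := by
      rw [Filter.eventually_all_finite hU]
      intro u hu
      rw [Filter.eventually_all_finset]
      intro a _
      have h1 := hgood u (hUg u hu)
      rw [← hpq a] at h1
      exact h1
    exact (hq.and h).exists
  choose f hf1 hf2 using step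
  let st : ℕ → {U : Set (List Λ) // U.Finite ∧ ∀ u ∈ U, good u} := fun n =>
    Nat.rec ⟨{[]}, Set.finite_singleton _, by
      rintro u rfl
      simpa [good] using hA⟩
      (fun n U => ⟨Set.image2 (fun u a => u ++ sub a (f n U)) U.1 (F n),
        U.2.1.image2 _ (F n).finite_toSet, by
          rintro _ ⟨u, hu, a, ha, rfl⟩
          exact (hf2 n U u hu a ha).2⟩) n
  refine ⟨j, fun n => f n (st n), fun n => hf1 _ _, fun l hl n => ?_⟩
  have key : ∀ n, W (fun n => f n (st n)) l n ∈ (st n).1 := by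
    intro n
    induction n with
    | zero => exact rfl
    | succ n ih => exact ⟨_, ih, l n, hl n, rfl⟩
  exact (hf2 n (st n) _ (key n) (l n) (hl n)).1

end HLproof

namespace HLproof

open Filter

theorem perfect_ext {T : Set (List Bool)} (hT : IsPerfectTree T) {t : List Bool} (ht : t ∈ T)
    (m : ℕ) (hm : t.length ≤ m) : ∃ x ∈ T, t <+: x ∧ x.length = m := by
  induction m, hm using Nat.le_induction with
  | base => exact ⟨t, ht, List.prefix_rfl, rfl⟩
  | succ m hm ih =>
    obtain ⟨x, hx, htx, rfl⟩ := ih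
    obtain ⟨s, hs, hs1, hs2, hs3⟩ := hT.2.2 x hx
    have hx' : x <+: s ++ [false] := hs.trans (List.prefix_append _ _)
    have hlen : x.length + 1 ≤ (s ++ [false]).length := by
      have := hs.length_le
      simp; omega
    refine ⟨(s ++ [false]).take (x.length + 1), hT.1 _ hs2 _ (List.take_prefix _ _), ?_, ?_⟩
    · refine htx.trans ?_
      exact List.prefix_of_prefix_length_le hx' (List.take_prefix _ _)
        (by rw [List.length_take]; omega)
    · rw [List.length_take]; omega

theorem perfect_split {T : Set (List Bool)} (hT : IsPerfectTree T) {t : List Bool} (ht : t ∈ T) :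
    ∀ᶠ m in atTop, ∃ x ∈ T, ∃ y ∈ T, t <+: x ∧ t <+: y ∧ x.length = m ∧ y.length = m ∧ x ≠ y := by
  obtain ⟨s, hs, hs1, hs2, hs3⟩ := hT.2.2 t ht
  filter_upwards [eventually_ge_atTop (s.length + 1)] with m hm
  obtain ⟨x, hx, hsx, hxm⟩ := perfect_ext hT hs2 m (by simpa using hm)
  obtain ⟨y, hy, hsy, hym⟩ := perfect_ext hT hs3 m (by simpa using hm)
  refine ⟨x, hx, y, hy, (hs.trans (List.prefix_append _ _)).trans hsx,
    (hs.trans (List.prefix_append _ _)).trans hsy, hxm, hym, ?_⟩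
  rintro rfl
  have := List.prefix_of_prefix_length_le hsx hsy (by simp)
  have := this.eq_of_length (by simp)
  simp at this

theorem exists_nxt (p : ℕ → Set (List Bool)) (hp : ∀ i, IsPerfectTree (p i))
    (A : Set ℕ) (hA : A.Infinite) (m : ℕ) : ∃ m' ∈ A, m < m' ∧ ∀ i ≤ m, ∀ t ∈ p i, t.length = m →
      ∃ x ∈ p i, ∃ y ∈ p i, t <+: x ∧ t <+: y ∧ x.length = m' ∧ y.length = m' ∧ x ≠ y := by
  have h1 : ∃ᶠ m' in atTop, m' ∈ A := Nat.frequently_atTop_iff_infinite.mpr hA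
  have h2 : ∀ᶠ m' in atTop, ∀ i ∈ Set.Iic m, ∀ t ∈ {t : List Bool | t.length = m}, t ∈ p i →
      ∃ x ∈ p i, ∃ y ∈ p i, t <+: x ∧ t <+: y ∧ x.length = m' ∧ y.length = m' ∧ x ≠ y := by
    rw [Filter.eventually_all_finite (Set.finite_Iic m)]
    intro i _
    rw [Filter.eventually_all_finite (List.finite_length_eq Bool m)]
    intro t _
    by_cases ht : t ∈ p i
    · filter_upwards [perfect_split (hp i) ht] with m' h _ using h
    · exact Eventually.of_forall fun _ h => absurd h ht
  obtain ⟨m', h3, h4, h5⟩ := (h1.and_eventually (h2.and (eventually_gt_atTop m))).exists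
  exact ⟨m', h3, h5, fun i hi t ht htm => h4 i hi t htm ht⟩

/-- extension function -/
theorem exists_ext (p : ℕ → Set (List Bool)) (hp : ∀ i, IsPerfectTree (p i))
    (nxt : ℕ → ℕ) (h1 : ∀ m, m < nxt m) (h2 : ∀ m, ∀ i ≤ m, ∀ t ∈ p i, t.length = m →
      ∃ x ∈ p i, ∃ y ∈ p i, t <+: x ∧ t <+: y ∧ x.length = nxt m ∧ y.length = nxt m ∧ x ≠ y)
    (i : ℕ) : ∃ E : List Bool → Bool → List Bool, ∀ t ∈ p i,
      (∀ b, E t b ∈ p i ∧ t <+: E t b ∧ (E t b).length = nxt t.length) ∧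
      (i ≤ t.length → ∀ b b', E t b = E t b' → b = b') := by
  have : ∀ t : List Bool, ∃ e : Bool → List Bool, t ∈ p i →
      (∀ b, e b ∈ p i ∧ t <+: e b ∧ (e b).length = nxt t.length) ∧
      (i ≤ t.length → ∀ b b', e b = e b' → b = b') := by
    intro t
    by_cases ht : t ∈ p i
    · by_cases hi : i ≤ t.length
      · obtain ⟨x, hx, y, hy, h3, h4, h5, h6, h7⟩ := h2 _ i hi t ht rfl
        refine ⟨fun b => if b then x else y, fun _ => ⟨?_, ?_⟩⟩
        · intro b; cases b <;> simp [*]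
        · intro _ b b'
          cases b <;> cases b' <;> simp [h7, h7.symm]
      · obtain ⟨x, hx, h3, h4⟩ := perfect_ext (hp i) ht (nxt t.length) (h1 _).le
        exact ⟨fun _ => x, fun _ => ⟨fun _ => ⟨hx, h3, h4⟩, fun h => absurd h hi⟩⟩
    · exact ⟨fun _ => [], fun h => absurd h ht⟩
  choose E hE using this
  exact ⟨E, hE⟩

section fold
variable {P : Set (List Bool)} {E : List Bool → Bool → List Bool} {nxt : ℕ → ℕ} {i : ℕ}

theorem fold_mem (hE : ∀ t ∈ P, (∀ b, E t b ∈ P ∧ t <+: E t b ∧ (E t b).length = nxt t.length))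
    (y : List Bool) : ∀ t ∈ P, y.foldl E t ∈ P ∧ t <+: y.foldl E t ∧
      (y.foldl E t).length = nxt^[y.length] t.length := by
  induction y with
  | nil => intro t ht; exact ⟨ht, List.prefix_rfl, rfl⟩
  | cons b y ih =>
    intro t ht
    obtain ⟨h1, h2, h3⟩ := hE t ht b
    obtain ⟨h4, h5, h6⟩ := ih _ h1
    refine ⟨h4, h2.trans h5, ?_⟩
    simp only [List.foldl_cons, List.length_cons, Function.iterate_succ, Function.comp_apply]
    rw [h6, h3]

theorem fold_inj (hE : ∀ t ∈ P, (∀ b, E t b ∈ P ∧ t <+: E t b ∧ (E t b).length = nxt t.length))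
    (hE2 : ∀ t ∈ P, i ≤ t.length → ∀ b b', E t b = E t b' → b = b')
    (x : List Bool) : ∀ (y : List Bool), ∀ t ∈ P, i ≤ t.length → x.length = y.length →
      x.foldl E t = y.foldl E t → x = y := by
  induction x with
  | nil => intro y t _ _ h _; exact (List.length_eq_zero_iff.mp h.symm).symm
  | cons b x ih =>
    intro y t ht hi hl h
    cases y with
    | nil => simp at hl
    | cons b' y =>
      simp only [List.foldl_cons] at h
      obtain ⟨h1, h2, h3⟩ := hE t ht b
      obtain ⟨h1', h2', h3'⟩ := hE t ht b'
      have e1 := (fold_mem hE x _ h1).2.1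
      have e2 := (fold_mem hE y _ h1').2.1
      rw [h] at e1
      have e3 : E t b = E t b' :=
        (List.prefix_of_prefix_length_le e1 e2 (by omega)).eq_of_length (by omega)
      obtain rfl := hE2 t ht hi _ _ e3
      rw [ih y _ h1 (hi.trans h2.length_le) (by simpa using hl) h]
end fold

/-- Two distinct nodes of the same length above `s` give a splitting node. -/
theorem exists_split {T : Set (List Bool)} (hT : IsBinTree T) (s x : List Bool) :
    ∀ (y : List Bool), s ++ x ∈ T → s ++ y ∈ T → x.length = y.length → x ≠ y →
      ∃ t, s <+: t ∧ IsSplitNode T t := by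
  induction x generalizing s with
  | nil => intro y _ _ h hne; exact absurd (List.length_eq_zero_iff.mp h.symm).symm hne
  | cons b x ih =>
    intro y hx hy hl hne
    cases y with
    | nil => simp at hl
    | cons b' y =>
      by_cases hb : b = b'
      · subst hb
        obtain ⟨t, h1, h2⟩ := ih (s ++ [b]) y (by simpa using hx) (by simpa using hy)
          (by simpa using hl) (by simpa using hne)
        exact ⟨t, (List.prefix_append _ _).trans h1, h2⟩
      · have h1 : s ++ [b] ∈ T := hT _ hx _ ⟨x, by simp⟩
        have h2 : s ++ [b'] ∈ T := hT _ hy _ ⟨y, by simp⟩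
        refine ⟨s, List.prefix_rfl, hT _ hx _ (List.prefix_append _ _), ?_⟩
        cases b <;> cases b' <;> simp_all

/-- The bits of a word of finite sets at coordinate `i`. -/
def bits (i : ℕ) (u : List (Finset ℕ)) : List Bool := u.map (fun s => decide (i ∈ s))

theorem bits_append (i : ℕ) (u v : List (Finset ℕ)) : bits i (u ++ v) = bits i u ++ bits i v :=
  List.map_append

theorem bits_sub_congr (i : ℕ) (a b : Finset ℕ) (h : i ∈ a ↔ i ∈ b) (w : List (Option (Finset ℕ))) :
    bits i (sub a w) = bits i (sub b w) := by
  simp only [bits, sub, List.map_map]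
  apply List.map_congr_left
  intro o _
  cases o <;> simp [h]

theorem bits_sub_ne (i : ℕ) (w : List (Option (Finset ℕ))) (hw : none ∈ w) :
    bits i (sub ∅ w) ≠ bits i (sub {i} w) := by
  simp only [bits, sub, List.map_map]
  intro h
  have := List.map_inj_left.mp h none hw
  simp at this

theorem bits_W_congr (i : ℕ) (w : ℕ → List (Option (Finset ℕ))) (l l' : ℕ → Finset ℕ) (n : ℕ)
    (h : ∀ m < n, i ∈ l m ↔ i ∈ l' m) : bits i (W w l n) = bits i (W w l' n) := by
  induction n with
  | zero => rfl
  | succ n ih =>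
    simp only [W, bits_append]
    rw [ih (fun m hm => h m (by omega)), bits_sub_congr i _ _ (h n (by omega))]

theorem length_sub {Λ : Type*} (a : Λ) (w : List (Option Λ)) : (sub a w).length = w.length := by
  simp [sub]

theorem length_W {Λ : Type*} (w : ℕ → List (Option Λ)) (l : ℕ → Λ) (n : ℕ) :
    (W w l n).length = ∑ i ∈ Finset.range n, (w i).length := by
  induction n with
  | zero => rfl
  | succ n ih => simp [W, ih, length_sub, Finset.sum_range_succ]

end HLproof

open HLproof in
/-- Halpern–Läuchli for infinitely many perfect trees, finitely many colours and a
prescribed infinite level set: for every sequence `p` of perfect trees, infinite `A ⊆ ω`,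
`k ≥ 1` and colouring `c : ⊗^A p → k` there are perfect trees `q(i) ⊆ p(i)` and an
infinite `B ⊆ A` such that `c` is constant on `⊗^B q`. -/
theorem halpern_lauchli (p : ℕ → Set (List Bool)) (hp : ∀ i, IsPerfectTree (p i))
    (A : Set ℕ) (hA : A.Infinite) (k : ℕ) (hk : 1 ≤ k)
    (c : (ℕ → List Bool) → Fin k) :
    ∃ q : ℕ → Set (List Bool), (∀ i, IsPerfectTree (q i) ∧ q i ⊆ p i) ∧
      ∃ B ⊆ A, B.Infinite ∧ ∃ j : Fin k, ∀ x ∈ tensorProd q B, c x = j := by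
  choose nxt hnA hnlt hns using exists_nxt p hp A hA
  choose E hE using exists_ext p hp nxt hnlt hns
  have hE1 := fun i t ht => (hE i t ht).1
  have hE2 := fun i t ht => (hE i t ht).2
  have hroot : ∀ i, [] ∈ p i := fun i => by
    obtain ⟨s, hs⟩ := (hp i).2.1
    exact (hp i).1 s hs _ List.nil_prefix
  let φ : ℕ → List (Finset ℕ) → List Bool := fun i u => (bits i u).foldl (E i) []
  let a : ℕ → ℕ := fun n => nxt^[n] 0
  have ha : StrictMono a := strictMono_nat_of_lt_succ fun n => by
    simp only [a, Function.iterate_succ_apply']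
    exact hnlt _
  have haA : ∀ n, 1 ≤ n → a n ∈ A := fun n hn => by
    obtain ⟨m, rfl⟩ := Nat.exists_eq_add_of_le' hn
    simp only [a, Function.iterate_succ_apply']
    exact hnA _
  have hφp : ∀ i u, φ i u ∈ p i := fun i u => (fold_mem (hE1 i) _ _ (hroot i)).1
  have hφl : ∀ i u, (φ i u).length = a u.length := fun i u => by
    have := (fold_mem (hE1 i) (bits i u) _ (hroot i)).2.2
    simpa [bits, φ, a] using this
  have hφapp : ∀ i u v, φ i (u ++ v) = (bits i v).foldl (E i) (φ i u) := fun i u v => by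
    simp only [φ, bits_append, List.foldl_append]
  have hφpre : ∀ i u v, φ i u <+: φ i (u ++ v) := fun i u v => by
    rw [hφapp]
    exact (fold_mem (hE1 i) _ _ (hφp i u)).2.1
  obtain ⟨j, w, hw, hj⟩ := carlson (fun n => (Finset.range n).powerset) (fun u => c (fun i => φ i u))
  let N : ℕ → ℕ := fun n => ∑ i ∈ Finset.range n, (w i).length
  have hN : StrictMono N := strictMono_nat_of_lt_succ fun n => by
    have := List.length_pos_of_mem (hw n)
    simp only [N, Finset.sum_range_succ]
    omega
  have hmono : ∀ i l m n, m ≤ n → φ i (W w l m) <+: φ i (W w l n) := by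
    intro i l m n hmn
    induction n, hmn using Nat.le_induction with
    | base => exact List.prefix_rfl
    | succ n _ ih => exact ih.trans (hφpre _ _ _)
  let G : Set (ℕ → Finset ℕ) := {l | ∀ n, l n ⊆ Finset.range n}
  let q : ℕ → Set (List Bool) := fun i => {s | ∃ l ∈ G, ∃ n, s <+: φ i (W w l n)}
  have hqtree : ∀ i, IsBinTree (q i) := by
    rintro i s ⟨l, hl, n, h⟩ t ht
    exact ⟨l, hl, n, ht.trans h⟩
  refine ⟨q, fun i => ⟨⟨hqtree i, ⟨[], fun _ => ∅, fun n => by simp, 0, List.nil_prefix⟩, ?_⟩, ?_⟩,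
    Set.range (fun n => a (N (n + 1))), ?_, ?_, j, ?_⟩
  · rintro s ⟨l, hl, n, hs⟩
    let m := max n (i + 1)
    have hs' := hs.trans (hmono i l n m (le_max_left _ _))
    have hi : i + 1 ≤ m := le_max_right _ _
    have hq : ∀ b ⊆ Finset.range m, (bits i (sub b (w m))).foldl (E i) (φ i (W w l m)) ∈ q i := by
      intro b hb
      refine ⟨Function.update l m b, ?_, m + 1, ?_⟩
      · intro n'
        by_cases h : n' = m
        · subst h; simpa using hb
        · simpa [Function.update_of_ne h] using hl n'
      · simp only [W, Function.update_self]
        rw [hφapp, W_congr w w (Function.update l m b) l m]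
        intro i' hi'
        exact ⟨rfl, Function.update_of_ne hi'.ne _ _⟩
    have q0 := hq ∅ (by simp)
    have q1 := hq {i} (by simp; omega)
    have ht := hφp i (W w l m)
    have hlen : i ≤ (φ i (W w l m)).length := by
      rw [hφl, length_W]
      have h1 : m ≤ N m := hN.le_apply
      have h2 : N m ≤ a (N m) := ha.le_apply
      change i ≤ a (N m)
      omega
    have hne : (bits i (sub ∅ (w m))).foldl (E i) (φ i (W w l m)) ≠
        (bits i (sub {i} (w m))).foldl (E i) (φ i (W w l m)) := fun h =>
      bits_sub_ne i (w m) (hw m) (fold_inj (hE1 i) (hE2 i) _ _ _ ht hlen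
        (by simp [bits, length_sub]) h)
    obtain ⟨_, ⟨x, hx⟩, lx⟩ := fold_mem (hE1 i) (bits i (sub ∅ (w m))) _ ht
    obtain ⟨_, ⟨y, hy⟩, ly⟩ := fold_mem (hE1 i) (bits i (sub {i} (w m))) _ ht
    rw [← hx] at q0 hne lx
    rw [← hy] at q1 hne ly
    obtain ⟨t, h1, h2⟩ := exists_split (hqtree i) _ x y q0 q1
      (by simp [bits, length_sub] at lx ly; omega) (fun h => hne (by rw [h]))
    exact ⟨t, hs'.trans h1, h2⟩
  · rintro s ⟨l, hl, n, hs⟩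
    exact (hp i).1 _ (hφp i _) _ hs
  · rintro _ ⟨n, rfl⟩
    exact haA _ ((Nat.succ_le_succ (Nat.zero_le n)).trans hN.le_apply)
  · apply Set.infinite_range_of_injective
    intro m n h
    have := hN.injective (ha.injective h)
    omega
  · rintro x ⟨_, ⟨n, rfl⟩, hx⟩
    choose hxq hxl using hx
    choose l hl m hm using hxq
    have hxe : ∀ i, x i = φ i (W w (l i) (n + 1)) := by
      intro i
      have e1 := (hm i).trans (hmono i (l i) _ _ (le_max_left (m i) (n + 1)))
      have e2 := hmono i (l i) _ _ (le_max_right (m i) (n + 1))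
      have e3 : (x i).length = (φ i (W w (l i) (n + 1))).length := by
        rw [hxl, hφl, length_W]
      exact (List.prefix_of_prefix_length_le e1 e2 e3.le).eq_of_length e3
    let L : ℕ → Finset ℕ := fun n => (Finset.range n).filter (fun i => i ∈ l i n)
    have hL : ∀ i, x i = φ i (W w L (n + 1)) := by
      intro i
      rw [hxe]
      simp only [φ]
      rw [bits_W_congr i w (l i) L]
      intro m' _
      simp only [L, Finset.mem_filter]
      exact ⟨fun h => ⟨hl i m' h, h⟩, fun h => h.2⟩
    rw [show x = fun i => φ i (W w L (n + 1)) from funext hL]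
    exact hj L (fun n' => by simp [L]) n
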